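/- arXiv:1912.03977 — 5 statements merged into one kernel-verified Lean document; each statement's English description precedes it below -/
import Mathlib

section
/- Dominant rate of decay in probability: let (W_n)_{n≥2} be real-valued random variables, H > 0, and let (c_n)_{n≥2} be positive reals with lim_{n→∞} log c_n / log n = −H. Suppose W_n / c_n converges in distribution to a random variable Z with P(Z = 0) = 0. Then for every δ > 0, P( n^{−H−δ} < |W_n| < n^{−H+δ} ) → 1 as n → ∞; equivalently, log|W_n| / log n converges in probability to −H. -/
open MeasureTheory Filter Real

/-- If probability measures converge weakly to a law without an atom at `0`, then asymptotically
all their mass lies in the annuli `l n < |x| < u n`, whenever `l n → 0` and `u n → ∞`. -/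
theorem tendsto_measure_annulus_of_tendsto {ν : ℕ → ProbabilityMeasure ℝ}
    {μ : ProbabilityMeasure ℝ} (hν : Tendsto ν atTop (nhds μ)) (hμ0 : (μ : Measure ℝ) {0} = 0)
    {l u : ℕ → ℝ} (hl : Tendsto l atTop (nhds 0)) (hu : Tendsto u atTop atTop) :
    Tendsto (fun n => (ν n : Measure ℝ) {x | l n < |x| ∧ |x| < u n}) atTop (nhds 1) := by
  set G : ℕ → Set ℝ := fun k => {x | 1 / ((k : ℝ) + 1) < |x| ∧ |x| < k + 1}
  have hGopen (k : ℕ) : IsOpen (G k) :=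
    (isOpen_lt continuous_const continuous_abs).inter (isOpen_lt continuous_abs continuous_const)
  have hGmono : Monotone G := by
    intro j k hjk x hx
    have hjk' : (j : ℝ) ≤ k := by exact_mod_cast hjk
    exact ⟨(one_div_le_one_div_of_le (by positivity) (by linarith)).trans_lt hx.1,
      hx.2.trans_le (by linarith)⟩
  have hGunion : ⋃ k, G k = {0}ᶜ := by
    ext x
    simp only [Set.mem_iUnion, Set.mem_compl_iff, Set.mem_singleton_iff]
    constructor
    · rintro ⟨k, hk, -⟩ rfl
      rw [abs_zero] at hk
      exact hk.not_ge (by positivity)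
    · intro hx
      have hsmall := (tendsto_one_div_add_atTop_nhds_zero_nat (𝕜 := ℝ)).eventually_lt_const
        (abs_pos.2 hx)
      have hlarge := (tendsto_natCast_atTop_atTop (R := ℝ)).eventually_gt_atTop |x|
      obtain ⟨k, hk₁, hk₂⟩ := (hsmall.and hlarge).exists
      exact ⟨k, hk₁, by linarith⟩
  have hGlim : Tendsto (fun k => (μ : Measure ℝ) (G k)) atTop (nhds 1) := by
    have h := tendsto_measure_iUnion_atTop (μ := (μ : Measure ℝ)) hGmono
    rwa [hGunion, prob_compl_eq_one_sub (measurableSet_singleton 0), hμ0, tsub_zero] at h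
  refine tendsto_order.2 ⟨fun a ha => ?_, fun a ha => ?_⟩
  · obtain ⟨k, hk⟩ := (hGlim.eventually_const_lt ha).exists
    have hliminf :=
      hk.trans_le (ProbabilityMeasure.le_liminf_measure_open_of_tendsto hν (hGopen k))
    filter_upwards [eventually_lt_of_lt_liminf hliminf,
      hl.eventually_lt_const (show (0 : ℝ) < 1 / ((k : ℝ) + 1) by positivity),
      hu.eventually_gt_atTop ((k : ℝ) + 1)] with n hn hln hun
    exact hn.trans_le (measure_mono fun x hx => ⟨hln.trans hx.1, hx.2.trans hun⟩)
  · exact Eventually.of_forall fun n => prob_le_one.trans_lt ha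

theorem tendsto_probabilityMeasure_map_of_tendsto_integral {Ω : Type*} [MeasurableSpace Ω]
    {P : Measure Ω} [IsProbabilityMeasure P] {X : ℕ → Ω → ℝ} (hX : ∀ n, Measurable (X n))
    {μ : Measure ℝ} [IsProbabilityMeasure μ]
    (h : ∀ f : BoundedContinuousFunction ℝ ℝ,
      Tendsto (fun n => ∫ ω, f (X n ω) ∂P) atTop (nhds (∫ x, f x ∂μ))) :
    Tendsto (β := ProbabilityMeasure ℝ)
      (fun n => ⟨P.map (X n), Measure.isProbabilityMeasure_map (hX n).aemeasurable⟩) atTop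
      (nhds ⟨μ, inferInstance⟩) := by
  refine ProbabilityMeasure.tendsto_iff_forall_integral_tendsto.2 fun f => ?_
  refine (h f).congr fun n => ?_
  exact (integral_map (hX n).aemeasurable f.continuous.aestronglyMeasurable).symm

theorem rpow_div_eq_exp_log_mul {x y : ℝ} (hx : 1 < x) (hy : 0 < y) (p : ℝ) :
    x ^ p / y = Real.exp (Real.log x * (p - Real.log y / Real.log x)) := by
  have hlog : Real.log x ≠ 0 := (Real.log_pos hx).ne'
  rw [mul_sub, mul_div_cancel₀ _ hlog, Real.exp_sub, Real.exp_log hy,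
    Real.rpow_def_of_pos (by linarith)]

theorem tendsto_log_natCast_atTop : Tendsto (fun n : ℕ => Real.log n) atTop atTop :=
  Real.tendsto_log_atTop.comp tendsto_natCast_atTop_atTop

theorem tendsto_rpow_div_nhds_zero {c : ℕ → ℝ} (hc : ∀ n, 0 < c n) {r p : ℝ}
    (hcr : Tendsto (fun n : ℕ => Real.log (c n) / Real.log n) atTop (nhds r)) (hp : p < r) :
    Tendsto (fun n : ℕ => (n : ℝ) ^ p / c n) atTop (nhds 0) := by
  refine (Real.tendsto_exp_atBot.comp (tendsto_log_natCast_atTop.atTop_mul_neg (sub_neg.2 hp)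
    (hcr.const_sub p))).congr' ?_
  filter_upwards [eventually_gt_atTop 1] with n hn
  exact (rpow_div_eq_exp_log_mul (by exact_mod_cast hn) (hc n) p).symm

theorem tendsto_rpow_div_atTop {c : ℕ → ℝ} (hc : ∀ n, 0 < c n) {r p : ℝ}
    (hcr : Tendsto (fun n : ℕ => Real.log (c n) / Real.log n) atTop (nhds r)) (hp : r < p) :
    Tendsto (fun n : ℕ => (n : ℝ) ^ p / c n) atTop atTop := by
  refine (Real.tendsto_exp_atTop.comp (tendsto_log_natCast_atTop.atTop_mul_pos (sub_pos.2 hp)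
    (hcr.const_sub p))).congr' ?_
  filter_upwards [eventually_gt_atTop 1] with n hn
  exact (rpow_div_eq_exp_log_mul (by exact_mod_cast hn) (hc n) p).symm

theorem abs_log_div_log_sub_le {x w r δ : ℝ} (hx : 1 < x) (hlow : x ^ (r - δ) < w)
    (hupp : w < x ^ (r + δ)) : |Real.log w / Real.log x - r| ≤ δ := by
  have hx0 : 0 < x := by linarith
  have hlog : 0 < Real.log x := Real.log_pos hx
  have h₁ := Real.log_lt_log (Real.rpow_pos_of_pos hx0 _) hlow
  have h₂ := Real.log_lt_log ((Real.rpow_pos_of_pos hx0 _).trans hlow) hupp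
  rw [Real.log_rpow hx0] at h₁ h₂
  rw [← lt_div_iff₀ hlog] at h₁
  rw [← div_lt_iff₀ hlog] at h₂
  exact abs_le.2 ⟨by linarith, by linarith⟩

/-- Dominant rate of decay in probability: if `log c_n / log n → -H` with `c_n > 0`, and
`W_n / c_n` converges in distribution to a law `μ` with no atom at `0`, then
`P(n^{-H-δ} < |W_n| < n^{-H+δ}) → 1` for every `δ > 0`; equivalently,
`log|W_n| / log n → -H` in probability. -/
theorem dominant_rate_of_decay
    {Ω : Type*} [MeasurableSpace Ω] (P : Measure Ω) [IsProbabilityMeasure P]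
    (W : ℕ → Ω → ℝ) (hWmeas : ∀ n, Measurable (W n))
    (H : ℝ) (hH : 0 < H)
    (c : ℕ → ℝ) (hc : ∀ n, 0 < c n)
    (hcH : Tendsto (fun n : ℕ => Real.log (c n) / Real.log n) atTop (nhds (-H)))
    (μ : Measure ℝ) [IsProbabilityMeasure μ] (hμ0 : μ {0} = 0)
    (hconv : ∀ f : BoundedContinuousFunction ℝ ℝ,
      Tendsto (fun n : ℕ => ∫ ω, f (W n ω / c n) ∂P) atTop (nhds (∫ x, f x ∂μ))) :
    (∀ δ : ℝ, 0 < δ →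
      Tendsto (fun n : ℕ =>
          P {ω | (n : ℝ) ^ (-H - δ) < |W n ω| ∧ |W n ω| < (n : ℝ) ^ (-H + δ)})
        atTop (nhds 1)) ∧
    (∀ δ : ℝ, 0 < δ →
      Tendsto (fun n : ℕ =>
          P {ω | δ < |Real.log |W n ω| / Real.log n - (-H)|})
        atTop (nhds 0)) := by
  have hX (n : ℕ) : Measurable fun ω => W n ω / c n := (hWmeas n).div_const _
  have hlaw := tendsto_probabilityMeasure_map_of_tendsto_integral hX hconv
  have hset (n : ℕ) (p q : ℝ) :
      MeasurableSet {ω | (n : ℝ) ^ p < |W n ω| ∧ |W n ω| < (n : ℝ) ^ q} :=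
    (measurableSet_lt measurable_const (hWmeas n).abs).inter
      (measurableSet_lt (hWmeas n).abs measurable_const)
  have hmain (δ : ℝ) (hδ : 0 < δ) : Tendsto (fun n : ℕ =>
      P {ω | (n : ℝ) ^ (-H - δ) < |W n ω| ∧ |W n ω| < (n : ℝ) ^ (-H + δ)})
      atTop (nhds 1) := by
    refine (tendsto_measure_annulus_of_tendsto hlaw hμ0
      (tendsto_rpow_div_nhds_zero hc hcH (show -H - δ < -H by linarith))
      (tendsto_rpow_div_atTop hc hcH (show -H < -H + δ by linarith))).congr fun n => ?_
    have hannulus : MeasurableSet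
        {x : ℝ | (n : ℝ) ^ (-H - δ) / c n < |x| ∧ |x| < (n : ℝ) ^ (-H + δ) / c n} :=
      (measurableSet_lt measurable_const measurable_id.abs).inter
        (measurableSet_lt measurable_id.abs measurable_const)
    rw [ProbabilityMeasure.coe_mk, Measure.map_apply (hX n) hannulus]
    congr 1
    ext ω
    simp [abs_div, abs_of_pos (hc n), div_lt_div_iff_of_pos_right (hc n)]
  refine ⟨hmain, fun δ hδ => ?_⟩
  have hcompl : Tendsto (fun n : ℕ =>
      P {ω | (n : ℝ) ^ (-H - δ) < |W n ω| ∧ |W n ω| < (n : ℝ) ^ (-H + δ)}ᶜ)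
      atTop (nhds 0) := by
    simp_rw [prob_compl_eq_one_sub (hset _ _ _)]
    simpa using ENNReal.Tendsto.sub tendsto_const_nhds (hmain δ hδ) (Or.inl ENNReal.one_ne_top)
  refine tendsto_of_tendsto_of_tendsto_of_le_of_le' tendsto_const_nhds hcompl
    (Eventually.of_forall fun _ => zero_le) ?_
  filter_upwards [eventually_gt_atTop 1] with n hn
  refine measure_mono fun ω hω hmem => ?_
  exact (abs_log_div_log_sub_le (by exact_mod_cast hn) hmem.1 hmem.2).not_gt hω
end

section
/- Small-time moment asymptotics for Brownian motion with drift: let γ ∈ ℝ, σ > 0, t > 0 and q > 0. Then lim_{n→∞} n^{q/2} · ∫_ℝ |x|^q d(N(γt/n, σ²t/n))(x) = t^{q/2} · ∫_ℝ |x|^q d(N(0, σ²))(x), where N(m, v) denotes the Gaussian measure on ℝ with mean m and variance v. In other words, if X(s) = γs + σB(s) with B a standard Brownian motion, then n^{q/2} E|X(t/n)|^q → t^{q/2} E|N(0,σ²)|^q as n → ∞. -/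
open MeasureTheory Filter Real ProbabilityTheory

/-- A Gaussian variable with mean `c * m` and variance `c * v` has the law of `√c * (Y + √c * m)`
for `Y` centered Gaussian with variance `v`; this is the resulting scaling of absolute moments. -/
lemma integral_abs_rpow_gaussianReal_mul (m v q c : ℝ) (hv : 0 ≤ v) (hc : 0 ≤ c) :
    ∫ x, |x| ^ q ∂(gaussianReal (c * m) (c * v).toNNReal) =
      c ^ (q / 2) * ∫ x, |x + √c * m| ^ q ∂(gaussianReal 0 v.toNNReal) := by
  have hmap : gaussianReal (c * m) (c * v).toNNReal =
      (gaussianReal 0 v.toNNReal).map (fun x ↦ √c * (x + √c * m)) := by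
    have hcomp : (fun x ↦ √c * (x + √c * m)) = (√c * ·) ∘ (· + √c * m) := rfl
    rw [hcomp, ← Measure.map_map (by fun_prop) (by fun_prop), gaussianReal_map_add_const,
      gaussianReal_map_const_mul]
    congr 1
    · rw [zero_add, ← mul_assoc, mul_self_sqrt hc]
    · ext
      simp [Real.sq_sqrt hc, Real.coe_toNNReal _ hv, Real.coe_toNNReal _ (mul_nonneg hc hv)]
  rw [hmap, integral_map (by fun_prop)
    (Measurable.aestronglyMeasurable (by fun_prop)), ← integral_const_mul]
  congr with x
  rw [abs_mul, abs_of_nonneg (sqrt_nonneg c), mul_rpow (sqrt_nonneg c) (abs_nonneg _),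
    sqrt_eq_rpow, ← rpow_mul hc, one_div_mul_eq_div]

/-- Absolute moments are continuous under vanishing translations. -/
lemma tendsto_integral_abs_add_rpow {μ : Measure ℝ} [IsFiniteMeasure μ] {q : ℝ} (hq : 0 < q)
    (hμ : MemLp id (ENNReal.ofReal q) μ) :
    Tendsto (fun m ↦ ∫ x, |x + m| ^ q ∂μ) (nhds 0) (nhds (∫ x, |x| ^ q ∂μ)) := by
  have hbound : Integrable (fun x ↦ (|x| + 1) ^ q) μ := by
    have hmem : MemLp (fun x : ℝ ↦ |x| + 1) (ENNReal.ofReal q) μ := hμ.abs.add (memLp_const 1)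
    refine (hmem.integrable_norm_rpow (by simpa using hq) ENNReal.ofReal_ne_top).congr
      (.of_forall fun x ↦ ?_)
    simp only [ENNReal.toReal_ofReal hq.le, norm_eq_abs]
    rw [abs_of_nonneg (by positivity)]
  refine tendsto_integral_filter_of_dominated_convergence (fun x ↦ (|x| + 1) ^ q)
    (.of_forall fun m ↦ Measurable.aestronglyMeasurable (by fun_prop)) ?_ hbound (.of_forall fun x ↦ ?_)
  · filter_upwards [Metric.closedBall_mem_nhds (0 : ℝ) one_pos] with m hm
    refine .of_forall fun x ↦ ?_
    have hm1 : |m| ≤ 1 := by simpa using hm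
    rw [norm_of_nonneg (by positivity)]
    gcongr
    exact (abs_add_le x m).trans (by gcongr)
  · have hcont : Continuous fun m : ℝ ↦ |x + m| ^ q :=
      (continuous_const.add continuous_id).abs.rpow_const fun _ ↦ .inr hq.le
    simpa using hcont.tendsto 0

/-- Small-time moment asymptotics for Brownian motion with drift: for `γ ∈ ℝ`, `σ > 0`,
`t > 0` and `q > 0`, the `q`-th absolute moment of the Gaussian law `N(γt/n, σ²t/n)`
(the law of `X(t/n)` for `X(s) = γs + σB(s)`) satisfies
`n^{q/2} · E|X(t/n)|^q → t^{q/2} · E|N(0,σ²)|^q` as `n → ∞`. -/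
theorem brownian_with_drift_small_time_moments
    (γ σ t q : ℝ) (hσ : 0 < σ) (ht : 0 < t) (hq : 0 < q) :
    Tendsto (fun n : ℕ => (n : ℝ) ^ (q / 2) *
        ∫ x, |x| ^ q ∂(gaussianReal (γ * t / n) ((σ ^ 2 * t / n).toNNReal)))
      atTop
      (nhds (t ^ (q / 2) * ∫ x, |x| ^ q ∂(gaussianReal 0 ((σ ^ 2).toNNReal)))) := by
  have hshift : Tendsto (fun n : ℕ ↦ √(t / n) * γ) atTop (nhds 0) := by
    simpa using ((tendsto_const_div_atTop_nhds_zero_nat t).sqrt).mul_const γ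
  have hlim := (tendsto_integral_abs_add_rpow hq
    (memLp_id_gaussianReal' (μ := 0) (v := (σ ^ 2).toNNReal) _ ENNReal.ofReal_ne_top)).comp hshift
  refine (hlim.const_mul (t ^ (q / 2))).congr' ?_
  filter_upwards [eventually_gt_atTop 0] with n hn
  have hn' : (0 : ℝ) < n := by exact_mod_cast hn
  rw [show γ * t / n = t / n * γ by ring, show σ ^ 2 * t / n = t / n * σ ^ 2 by ring,
    integral_abs_rpow_gaussianReal_mul _ _ _ _ (sq_nonneg σ) (by positivity), ← mul_assoc,
    ← mul_rpow hn'.le (by positivity), mul_div_cancel₀ _ hn'.ne']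
  rfl
end

section
/- Dominant scale in the multiscale behavior: let 0 < α < β ≤ ∞ and let (W_n)_{n≥2} be real-valued random variables with P(W_n = 0) = 0 for all n, such that for every q ∈ ℝ the limit τ(q) = lim_{n→∞} (1/log n)·log E|W_n|^q exists as an extended real number, 0 lies in the interior of { q : τ(q) < ∞ }, τ(q) = −q/α for 0 ≤ q ≤ α, τ(q) = −1 for α < q < β, and τ(q) = +∞ for q > β in case β < ∞. Then for every ε > 0: lim_{n→∞} (1/log n) · log P( n^{−1/α−ε} < |W_n| < n^{−1/α+ε} ) = 0. -/
open MeasureTheory Filter Real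
open scoped ENNReal

/-- Multiplication by `(log x)⁻¹` after `ENNReal.log` is monotone for `1 < x`. -/
theorem inv_log_mul_log_mono {x : ℝ} (hx : 1 < x) {a b : ℝ≥0∞} (hab : a ≤ b) :
    (((Real.log x)⁻¹ : ℝ) : EReal) * ENNReal.log a ≤
      (((Real.log x)⁻¹ : ℝ) : EReal) * ENNReal.log b :=
  mul_le_mul_of_nonneg_left (ENNReal.log_monotone hab)
    (EReal.coe_nonneg.2 (inv_nonneg.2 (Real.log_pos hx).le))

theorem inv_log_mul_log_rpow {x : ℝ} (hx : 1 < x) (c : ℝ) :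
    (((Real.log x)⁻¹ : ℝ) : EReal) * ENNReal.log (ENNReal.ofReal (x ^ c)) = c := by
  have h0 : 0 < x := zero_lt_one.trans hx
  rw [ENNReal.log_ofReal_of_pos (Real.rpow_pos_of_pos h0 c), Real.log_rpow h0, ← EReal.coe_mul]
  congr 1
  field_simp [(Real.log_pos hx).ne']

theorem ofReal_rpow_lt_of_lt_inv_log_mul_log {x c : ℝ} (hx : 1 < x) {a : ℝ≥0∞}
    (h : (c : EReal) < (((Real.log x)⁻¹ : ℝ) : EReal) * ENNReal.log a) :
    ENNReal.ofReal (x ^ c) < a := by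
  contrapose! h
  exact (inv_log_mul_log_mono hx h).trans_eq (inv_log_mul_log_rpow hx c)

theorem lt_ofReal_rpow_of_inv_log_mul_log_lt {x c : ℝ} (hx : 1 < x) {a : ℝ≥0∞}
    (h : (((Real.log x)⁻¹ : ℝ) : EReal) * ENNReal.log a < (c : EReal)) :
    a < ENNReal.ofReal (x ^ c) := by
  contrapose! h
  exact (inv_log_mul_log_rpow hx c).symm.trans_le (inv_log_mul_log_mono hx h)

/-- Splitting a moment of order `q ∈ [0, r]` according to whether `|X|` lies below, inside or above
the window `(l, u)`. -/
theorem lintegral_rpow_abs_le_window {Ω : Type*} [MeasurableSpace Ω] (P : Measure Ω)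
    [IsProbabilityMeasure P] {X : Ω → ℝ} (hX : Measurable X) {l u q r : ℝ}
    (hu : 0 < u) (hq : 0 ≤ q) (hqr : q ≤ r) :
    ∫⁻ ω, ENNReal.ofReal (|X ω| ^ q) ∂P ≤
      ENNReal.ofReal (l ^ q) +
        ENNReal.ofReal (u ^ (q - r)) * ∫⁻ ω, ENNReal.ofReal (|X ω| ^ r) ∂P +
        ENNReal.ofReal (u ^ q) * P {ω | l < |X ω| ∧ |X ω| < u} := by
  set S : Set Ω := {ω | l < |X ω| ∧ |X ω| < u}
  have hS : MeasurableSet S :=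
    (measurableSet_lt measurable_const hX.abs).inter (measurableSet_lt hX.abs measurable_const)
  have hr : Measurable fun ω => ENNReal.ofReal (|X ω| ^ r) :=
    (hX.abs.pow_const r).ennreal_ofReal
  calc
    _ ≤ ∫⁻ ω, (ENNReal.ofReal (l ^ q) + ENNReal.ofReal (u ^ (q - r)) *
          ENNReal.ofReal (|X ω| ^ r)) + S.indicator (fun _ => ENNReal.ofReal (u ^ q)) ω ∂P := by
      refine lintegral_mono fun ω => ?_
      by_cases hl : |X ω| ≤ l
      · exact le_add_right (le_add_right
          (ENNReal.ofReal_le_ofReal (Real.rpow_le_rpow (abs_nonneg _) hl hq)))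
      by_cases hu' : |X ω| < u
      · have hω : ω ∈ S := ⟨not_le.1 hl, hu'⟩
        simp only [Set.indicator_of_mem hω]
        exact le_add_left
          (ENNReal.ofReal_le_ofReal (Real.rpow_le_rpow (abs_nonneg _) hu'.le hq))
      · refine le_add_right (le_add_left ?_)
        have hXu : u ≤ |X ω| := not_lt.1 hu'
        rw [← ENNReal.ofReal_mul (by positivity)]
        refine ENNReal.ofReal_le_ofReal ?_
        calc |X ω| ^ q = |X ω| ^ (q - r) * |X ω| ^ r := by
              rw [← Real.rpow_add (hu.trans_le hXu), sub_add_cancel]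
          _ ≤ _ := by
              gcongr ?_ * _
              exact Real.rpow_le_rpow_of_nonpos hu hXu (sub_nonpos.2 hqr)
    _ = _ := by
      rw [lintegral_add_right _ (measurable_const.indicator hS),
        lintegral_add_left measurable_const, lintegral_const_mul _ hr,
        lintegral_indicator_const hS, lintegral_const, measure_univ, mul_one]

/-- If a measure of total mass one has its `q`-th moment nearly `x ^ (-q / α)` and its `α`-th
moment at most nearly `x⁻¹`, then the window around `x ^ (-1 / α)` has mass bounded below. -/
theorem rpow_le_measureReal_window {Ω : Type*} [MeasurableSpace Ω] (P : Measure Ω)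
    [IsProbabilityMeasure P] {X : Ω → ℝ} (hX : Measurable X) {x α ε q η : ℝ} (hx : 1 < x)
    (hα : 0 < α) (hε : 0 < ε) (hq : 0 < q) (hqα : 2 * q ≤ α) (hη : 4 * η = q * ε)
    (hxη : x ^ (-η) ≤ 1 / 2)
    (hlow : ENNReal.ofReal (x ^ (-(q / α) - η)) ≤ ∫⁻ ω, ENNReal.ofReal (|X ω| ^ q) ∂P)
    (hup : ∫⁻ ω, ENNReal.ofReal (|X ω| ^ α) ∂P ≤ ENNReal.ofReal (x ^ (-1 + η))) :
    x ^ (-(6 * η)) ≤ P.real {ω | x ^ (-(1 / α) - ε) < |X ω| ∧ |X ω| < x ^ (-(1 / α) + ε)} := by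
  have h0 : 0 < x := zero_lt_one.trans hx
  have key := lintegral_rpow_abs_le_window P hX (l := x ^ (-(1 / α) - ε))
    (Real.rpow_pos_of_pos h0 (-(1 / α) + ε)) hq.le (show q ≤ α by linarith)
  set S : Set Ω := {ω | x ^ (-(1 / α) - ε) < |X ω| ∧ |X ω| < x ^ (-(1 / α) + ε)}
  have key' : ENNReal.ofReal (x ^ (-(q / α) - η)) ≤
      ENNReal.ofReal ((x ^ (-(1 / α) - ε)) ^ q + (x ^ (-(1 / α) + ε)) ^ (q - α) * x ^ (-1 + η) +
        (x ^ (-(1 / α) + ε)) ^ q * P.real S) := by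
    rw [ENNReal.ofReal_add (by positivity) (by positivity),
      ENNReal.ofReal_add (by positivity) (by positivity),
      ENNReal.ofReal_mul (by positivity), ENNReal.ofReal_mul (by positivity), ofReal_measureReal]
    refine hlow.trans (key.trans ?_)
    gcongr
  rw [ENNReal.ofReal_le_ofReal_iff (by positivity)] at key'
  have e1 : (x ^ (-(1 / α) - ε)) ^ q = x ^ (-(q / α)) * x ^ (-(4 * η)) := by
    rw [← Real.rpow_mul h0.le, ← Real.rpow_add h0, hη]
    ring_nf
  have e2 : (x ^ (-(1 / α) + ε)) ^ (q - α) * x ^ (-1 + η) ≤ x ^ (-(q / α)) * x ^ (-(3 * η)) := by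
    rw [← Real.rpow_mul h0.le, ← Real.rpow_add h0, ← Real.rpow_add h0]
    refine Real.rpow_le_rpow_of_exponent_le hx.le ?_
    have : (-(1 / α) + ε) * (q - α) = -(q / α) + 1 - ε * (α - q) := by
      field_simp
      ring
    nlinarith
  have e3 : (x ^ (-(1 / α) + ε)) ^ q = x ^ (-(q / α)) * x ^ (4 * η) := by
    rw [← Real.rpow_mul h0.le, ← Real.rpow_add h0, hη]
    ring_nf
  have e4 : x ^ (-(q / α) - η) = x ^ (-(q / α)) * x ^ (-η) := by
    rw [← Real.rpow_add h0, sub_eq_add_neg]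
  have hpow (k : ℕ) : x ^ (-(k * η)) = (x ^ (-η)) ^ k := by
    rw [← Real.rpow_mul_natCast h0.le]
    ring_nf
  have h3 := hpow 3
  have h4 := hpow 4
  have h6 := hpow 6
  push_cast at h3 h4 h6
  have hy0 : 0 < x ^ (-η) := Real.rpow_pos_of_pos h0 _
  have hinv : x ^ (4 * η) * (x ^ (-η)) ^ 4 = 1 := by
    rw [← h4, ← Real.rpow_add h0, add_neg_cancel, Real.rpow_zero]
  have hz0 : 0 < x ^ (-(q / α)) := Real.rpow_pos_of_pos h0 _
  rw [h3] at e2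
  rw [e4, e1, e3, h4] at key'
  rw [h6]
  generalize x ^ (-η) = y at *
  generalize x ^ (-(q / α)) = z at *
  generalize x ^ (4 * η) = t at *
  have hmain : y ≤ y ^ 4 + y ^ 3 + t * P.real S := by
    refine le_of_mul_le_mul_left ?_ hz0
    linarith
  have hy2 : y ^ 2 ≤ t * P.real S := by
    have : y ^ 4 + y ^ 3 + y ^ 2 ≤ y := by
      have h2 : y ^ 2 ≤ y / 2 := by nlinarith
      have h3 : y ^ 3 ≤ y / 4 := by nlinarith
      have h4 : y ^ 4 ≤ y / 8 := by nlinarith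
      linarith
    linarith
  calc y ^ 6 = y ^ 4 * y ^ 2 := by ring
    _ ≤ y ^ 4 * (t * P.real S) := by gcongr
    _ = t * y ^ 4 * P.real S := by ring
    _ = P.real S := by rw [hinv, one_mul]

/-- Dominant scale in the multiscale behavior: if the scaling function
`τ(q) = lim_n (1/log n)·log E|W_n|^q` exists in the extended reals for every `q`, `0` is
interior to `{q | τ(q) < ∞}`, and `τ` has the intermittent form (`τ(q) = -q/α` on
`[0, α]`, `τ(q) = -1` on `(α, β)`, `τ(q) = +∞` for `q > β` if `β < ∞`), then for every
`ε > 0`, `(1/log n)·log P(n^{-1/α-ε} < |W_n| < n^{-1/α+ε}) → 0`. -/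
theorem multiscale_dominant_scale
    {Ω : Type*} [MeasurableSpace Ω] (P : Measure Ω) [IsProbabilityMeasure P]
    (W : ℕ → Ω → ℝ) (hWmeas : ∀ n, Measurable (W n))
    (hW0 : ∀ n, P {ω | W n ω = 0} = 0)
    (α : ℝ) (hα : 0 < α) (β : EReal) (hαβ : (α : EReal) < β)
    (τ : ℝ → EReal)
    (hτ : ∀ q : ℝ, Tendsto (fun n : ℕ =>
        (((Real.log n)⁻¹ : ℝ) : EReal) *
          ENNReal.log (∫⁻ ω, ENNReal.ofReal (|W n ω| ^ q) ∂P))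
      atTop (nhds (τ q)))
    (h0 : (0 : ℝ) ∈ interior {q : ℝ | τ q < ⊤})
    (hlin : ∀ q : ℝ, 0 ≤ q → q ≤ α → τ q = ((-(q / α) : ℝ) : EReal))
    (hflat : ∀ q : ℝ, α < q → (q : EReal) < β → τ q = -1)
    (htop : β < ⊤ → ∀ q : ℝ, β < (q : EReal) → τ q = ⊤) :
    ∀ ε : ℝ, 0 < ε →
      Tendsto (fun n : ℕ =>
          (((Real.log n)⁻¹ : ℝ) : EReal) *
            ENNReal.log (P {ω | (n : ℝ) ^ (-(1 / α) - ε) < |W n ω| ∧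
              |W n ω| < (n : ℝ) ^ (-(1 / α) + ε)}))
        atTop (nhds (0 : EReal)) := by
  intro ε hε
  have hlog : ∀ q : ℝ, 0 ≤ q → q ≤ α → ∀ η : ℝ, 0 < η → ∀ᶠ n : ℕ in atTop,
      ENNReal.ofReal ((n : ℝ) ^ (-(q / α) - η)) ≤ ∫⁻ ω, ENNReal.ofReal (|W n ω| ^ q) ∂P ∧
      ∫⁻ ω, ENNReal.ofReal (|W n ω| ^ q) ∂P ≤ ENNReal.ofReal ((n : ℝ) ^ (-(q / α) + η)) := by
    intro q hq hqα η hη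
    have ht := hτ q
    rw [hlin q hq hqα] at ht
    filter_upwards [ht.eventually_const_lt (EReal.coe_lt_coe_iff.2 (sub_lt_self _ hη)),
      ht.eventually_lt_const (EReal.coe_lt_coe_iff.2 (lt_add_of_pos_right _ hη)),
      eventually_gt_atTop 1] with n h1 h2 hn
    have hn' : (1 : ℝ) < n := by exact_mod_cast hn
    exact ⟨(ofReal_rpow_lt_of_lt_inv_log_mul_log hn' h1).le,
      (lt_ofReal_rpow_of_inv_log_mul_log_lt hn' h2).le⟩
  refine tendsto_order.2 ⟨fun a ha => ?_, fun b hb => ?_⟩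
  · obtain ⟨d, had, hd⟩ := EReal.lt_iff_exists_real_btwn.1 ha
    have hd0 : d < 0 := by exact_mod_cast hd
    obtain ⟨q, hq, hqα, hqd⟩ : ∃ q : ℝ, 0 < q ∧ 2 * q ≤ α ∧ 3 / 2 * (q * ε) ≤ -d := by
      refine ⟨min (α / 2) (2 / 3 * (-d) / ε), lt_min (by positivity)
        (div_pos (by linarith) hε), ?_, ?_⟩
      · linarith [min_le_left (α / 2) (2 / 3 * (-d) / ε)]
      · have := (le_div_iff₀ hε).1 (min_le_right (α / 2) (2 / 3 * (-d) / ε))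
        linarith
    have hη : 0 < q * ε / 4 := by positivity
    have hsmall : ∀ᶠ n : ℕ in atTop, (n : ℝ) ^ (-(q * ε / 4)) ≤ 1 / 2 :=
      ((tendsto_rpow_neg_atTop hη).comp tendsto_natCast_atTop_atTop).eventually_le_const
        (by norm_num)
    filter_upwards [hlog q hq.le (by linarith) _ hη, hlog α hα.le le_rfl _ hη, hsmall,
      eventually_gt_atTop 1] with n h1 h2 h3 hn
    have hn' : (1 : ℝ) < n := by exact_mod_cast hn
    rw [div_self hα.ne'] at h2
    have hP := rpow_le_measureReal_window P (hWmeas n) hn' hα hε hq hqα (by ring) h3 h1.1 h2.2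
    refine had.trans_le ?_
    rw [← inv_log_mul_log_rpow hn' d]
    refine inv_log_mul_log_mono hn' ?_
    rw [← ofReal_measureReal]
    refine ENNReal.ofReal_le_ofReal (le_trans ?_ hP)
    exact Real.rpow_le_rpow_of_exponent_le hn'.le (by linarith)
  · filter_upwards [eventually_gt_atTop 1] with n hn
    have hn' : (1 : ℝ) < n := by exact_mod_cast hn
    refine lt_of_le_of_lt ?_ hb
    refine (inv_log_mul_log_mono hn' prob_le_one).trans_eq ?_
    rw [ENNReal.log_one, mul_zero]
end

section
/- Secondary scale in the multiscale behavior: let 0 < α < β < ∞ and let (W_n)_{n≥2} be real-valued random variables with P(W_n = 0) = 0 for all n, such that for every q ∈ ℝ the limit τ(q) = lim_{n→∞} (1/log n)·log E|W_n|^q exists as an extended real number, 0 lies in the interior of { q : τ(q) < ∞ }, τ(q) = −q/α for 0 ≤ q ≤ α, τ(q) = −1 for α < q < β, and τ(q) = +∞ for q > β. Then for every ε > 0: −1 ≤ liminf_{n→∞} (1/log n)·log P( n^{−ε} < |W_n| < n^{ε} ) ≤ limsup_{n→∞} (1/log n)·log P( n^{−ε} < |W_n| < n^{ε} ) ≤ −1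 + α·ε. -/
open MeasureTheory Filter Real
open scoped ENNReal

/-- Normalised logarithms are bounded by `c` exactly when the quantity is bounded by `n ^ c`. -/
lemma inv_log_mul_log_le_iff {n : ℕ} (hn : 2 ≤ n) (x : ℝ≥0∞) (c : ℝ) :
    (((Real.log n)⁻¹ : ℝ) : EReal) * ENNReal.log x ≤ c ↔ x ≤ ENNReal.ofReal ((n : ℝ) ^ c) := by
  have hn0 : (0 : ℝ) < n := by positivity
  have hlog : 0 < Real.log n := Real.log_pos (by exact_mod_cast hn)
  rw [← ENNReal.log_le_log_iff, ENNReal.log_ofReal_of_pos (by positivity), Real.log_rpow hn0,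
    EReal.coe_inv, ← EReal.div_eq_inv_mul, EReal.coe_mul, mul_comm (c : EReal)]
  exact EReal.div_le_iff_le_mul (by exact_mod_cast hlog) (EReal.coe_ne_top _)

/-- Normalised logarithms are at least `c` exactly when the quantity is at least `n ^ c`. -/
lemma le_inv_log_mul_log_iff {n : ℕ} (hn : 2 ≤ n) (x : ℝ≥0∞) (c : ℝ) :
    (c : EReal) ≤ (((Real.log n)⁻¹ : ℝ) : EReal) * ENNReal.log x ↔
      ENNReal.ofReal ((n : ℝ) ^ c) ≤ x := by
  have hn0 : (0 : ℝ) < n := by positivity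
  have hlog : 0 < Real.log n := Real.log_pos (by exact_mod_cast hn)
  rw [← ENNReal.log_le_log_iff, ENNReal.log_ofReal_of_pos (by positivity), Real.log_rpow hn0,
    EReal.coe_inv, ← EReal.div_eq_inv_mul, EReal.coe_mul]
  exact EReal.le_div_iff_mul_le (by exact_mod_cast hlog) (EReal.coe_ne_top _)

lemma eventually_le_of_tendsto_inv_log {x : ℕ → ℝ≥0∞} {c d : ℝ} (hcd : c < d)
    (h : Tendsto (fun n : ℕ => (((Real.log n)⁻¹ : ℝ) : EReal) * ENNReal.log (x n))
      atTop (nhds (c : EReal))) :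
    ∀ᶠ n : ℕ in atTop, x n ≤ ENNReal.ofReal ((n : ℝ) ^ d) := by
  filter_upwards [h.eventually_lt_const (EReal.coe_lt_coe_iff.2 hcd), eventually_ge_atTop 2]
    with n hn hn2
  exact (inv_log_mul_log_le_iff hn2 _ _).1 hn.le

lemma eventually_ge_of_tendsto_inv_log {x : ℕ → ℝ≥0∞} {c d : ℝ} (hdc : d < c)
    (h : Tendsto (fun n : ℕ => (((Real.log n)⁻¹ : ℝ) : EReal) * ENNReal.log (x n))
      atTop (nhds (c : EReal))) :
    ∀ᶠ n : ℕ in atTop, ENNReal.ofReal ((n : ℝ) ^ d) ≤ x n := by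
  filter_upwards [h.eventually_const_lt (EReal.coe_lt_coe_iff.2 hdc), eventually_ge_atTop 2]
    with n hn hn2
  exact (le_inv_log_mul_log_iff hn2 _ _).1 hn.le

/-- Splitting `w ^ q` according to whether `w` is small, of constant order, or large. -/
lemma rpow_le_small_add_mid_add_large {n w q h : ℝ} (ε : ℝ) (hn : 1 < n) (hw : 0 ≤ w)
    (hh : 0 < h) (hqh : h < q) :
    w ^ q ≤ n ^ (-(ε * h)) * w ^ (q - h) +
      n ^ (ε * q) * (if n ^ (-ε) < w ∧ w < n ^ ε then 1 else 0) +
      n ^ (-(ε * h)) * w ^ (q + h) := by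
  have hn0 : 0 < n := by linarith
  have hq : 0 < q := hh.trans hqh
  rcases hw.eq_or_lt with rfl | hw0
  · rw [Real.zero_rpow hq.ne']
    positivity
  have hmid : 0 ≤ n ^ (ε * q) * (if n ^ (-ε) < w ∧ w < n ^ ε then (1 : ℝ) else 0) := by
    positivity
  have hlow : 0 ≤ n ^ (-(ε * h)) * w ^ (q - h) := by positivity
  have hhigh : 0 ≤ n ^ (-(ε * h)) * w ^ (q + h) := by positivity
  rcases le_or_gt w (n ^ (-ε)) with h1 | h1
  · have : w ^ h ≤ n ^ (-(ε * h)) := by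
      rw [show -(ε * h) = -ε * h by ring, Real.rpow_mul hn0.le]
      exact Real.rpow_le_rpow hw h1 hh.le
    have key : w ^ q = w ^ h * w ^ (q - h) := by
      rw [← Real.rpow_add hw0]; ring_nf
    have := mul_le_mul_of_nonneg_right this (Real.rpow_nonneg hw (q - h))
    linarith
  rcases lt_or_ge w (n ^ ε) with h2 | h2
  · rw [if_pos ⟨h1, h2⟩] at hmid ⊢
    have : w ^ q ≤ n ^ (ε * q) := by
      rw [Real.rpow_mul hn0.le]
      exact Real.rpow_le_rpow hw h2.le hq.le
    linarith
  · have : n ^ (ε * h) ≤ w ^ h := by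
      rw [Real.rpow_mul hn0.le]
      exact Real.rpow_le_rpow (by positivity) h2 hh.le
    have h3 : 1 ≤ n ^ (-(ε * h)) * w ^ h := by
      rw [Real.rpow_neg hn0.le, ← div_eq_inv_mul]
      exact (one_le_div (by positivity)).2 this
    have := mul_le_mul_of_nonneg_right h3 (Real.rpow_nonneg hw q)
    rw [mul_assoc, ← Real.rpow_add hw0, add_comm h q] at this
    linarith

lemma lintegral_rpow_le_small_add_mid_add_large {Ω : Type*} [MeasurableSpace Ω] (P : Measure Ω)
    {X : Ω → ℝ} (hX : Measurable X) {n q h : ℝ} (ε : ℝ) (hn : 1 < n)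
    (hh : 0 < h) (hqh : h < q) :
    ∫⁻ ω, ENNReal.ofReal (|X ω| ^ q) ∂P ≤
      ENNReal.ofReal (n ^ (-(ε * h))) * ∫⁻ ω, ENNReal.ofReal (|X ω| ^ (q - h)) ∂P +
      ENNReal.ofReal (n ^ (ε * q)) * P {ω | n ^ (-ε) < |X ω| ∧ |X ω| < n ^ ε} +
      ENNReal.ofReal (n ^ (-(ε * h))) * ∫⁻ ω, ENNReal.ofReal (|X ω| ^ (q + h)) ∂P := by
  have hn0 : 0 < n := by linarith
  have hS : MeasurableSet {ω | n ^ (-ε) < |X ω| ∧ |X ω| < n ^ ε} :=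
    (measurableSet_lt measurable_const hX.abs).inter (measurableSet_lt hX.abs measurable_const)
  rw [← lintegral_indicator_one hS, ← lintegral_const_mul _ (by fun_prop),
    ← lintegral_const_mul _ (measurable_one.indicator hS),
    ← lintegral_const_mul _ (by fun_prop),
    ← lintegral_add_left (by fun_prop), ← lintegral_add_right _ (by fun_prop)]
  refine lintegral_mono fun ω => ?_
  refine (ENNReal.ofReal_le_ofReal
    (rpow_le_small_add_mid_add_large ε hn (abs_nonneg (X ω)) hh hqh)).trans_eq ?_
  rw [ENNReal.ofReal_add (by positivity) (by positivity),
    ENNReal.ofReal_add (by positivity) (by positivity), ENNReal.ofReal_mul (by positivity),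
    ENNReal.ofReal_mul (by positivity), ENNReal.ofReal_mul (by positivity)]
  congr 3
  by_cases hω : n ^ (-ε) < |X ω| ∧ |X ω| < n ^ ε <;> simp [Set.indicator, hω]

lemma measure_lt_abs_le_rpow_mul_lintegral {Ω : Type*} [MeasurableSpace Ω] (P : Measure Ω)
    {X : Ω → ℝ} (hX : Measurable X) {n ε q : ℝ} (hn : 0 < n) (hq : 0 < q) :
    P {ω | n ^ (-ε) < |X ω|} ≤
      ENNReal.ofReal (n ^ (q * ε)) * ∫⁻ ω, ENNReal.ofReal (|X ω| ^ q) ∂P := by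
  rw [← lintegral_const_mul _ (by fun_prop), ← lintegral_indicator_one
    (measurableSet_lt measurable_const hX.abs)]
  refine lintegral_mono fun ω => Set.indicator_apply_le' (fun hω => ?_) fun _ => zero_le
  rw [← ENNReal.ofReal_mul (by positivity), Pi.one_apply, ENNReal.one_le_ofReal]
  calc (1 : ℝ) = n ^ (q * ε) * (n ^ (-ε)) ^ q := by
        rw [← Real.rpow_mul hn.le, ← Real.rpow_add hn]; ring_nf; simp
    _ ≤ n ^ (q * ε) * |X ω| ^ q := by
        gcongr
        exact (show n ^ (-ε) < |X ω| from hω).le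

/-- If the moments of orders `q - h`, `q`, `q + h` all decay like `n⁻¹`, then so does, up to an
arbitrarily small power, the probability that `|W n|` is of constant order. -/
lemma eventually_rpow_le_measure_mid {Ω : Type*} [MeasurableSpace Ω] (P : Measure Ω)
    [IsFiniteMeasure P] {W : ℕ → Ω → ℝ} (hW : ∀ n, Measurable (W n)) {q h : ℝ} (hh : 0 < h)
    (hqh : h < q) (hτ : ∀ p ∈ ({q - h, q, q + h} : Set ℝ), Tendsto (fun n : ℕ =>
        (((Real.log n)⁻¹ : ℝ) : EReal) *
          ENNReal.log (∫⁻ ω, ENNReal.ofReal (|W n ω| ^ p) ∂P))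
      atTop (nhds ((-1 : ℝ) : EReal))) {ε : ℝ} (hε : 0 < ε) :
    ∀ᶠ n : ℕ in atTop, ENNReal.ofReal ((n : ℝ) ^ (-1 - ε * (h / 2 + q))) ≤
      P {ω | (n : ℝ) ^ (-ε) < |W n ω| ∧ |W n ω| < (n : ℝ) ^ ε} := by
  obtain ⟨δ, hδ⟩ : ∃ δ, δ = ε * h / 4 := ⟨_, rfl⟩
  have hδ0 : 0 < δ := by rw [hδ]; positivity
  have htwo : ∀ᶠ n : ℕ in atTop, (2 : ℝ) ≤ (n : ℝ) ^ δ :=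
    ((tendsto_rpow_atTop hδ0).comp tendsto_natCast_atTop_atTop).eventually_ge_atTop 2
  filter_upwards [eventually_ge_of_tendsto_inv_log (d := -1 - δ) (by linarith)
      (hτ q (by simp)),
    eventually_le_of_tendsto_inv_log (d := -1 + δ) (by linarith) (hτ (q - h) (by simp)),
    eventually_le_of_tendsto_inv_log (d := -1 + δ) (by linarith) (hτ (q + h) (by simp)),
    htwo, eventually_ge_atTop 2] with n hq hl hr h2 hn
  have hn1 : (1 : ℝ) < n := by exact_mod_cast hn
  have hn0 : (0 : ℝ) < n := by positivity
  have key := hq.trans (lintegral_rpow_le_small_add_mid_add_large P (hW n) ε hn1 hh hqh)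
  have key2 := key.trans (add_le_add (add_le_add (mul_le_mul_right hl _) le_rfl)
    (mul_le_mul_right hr _))
  rw [← ofReal_measureReal, ← ENNReal.ofReal_mul (by positivity),
    ← ENNReal.ofReal_mul (by positivity), ← ENNReal.ofReal_add (by positivity) (by positivity),
    ← ENNReal.ofReal_add (by positivity) (by positivity),
    ENNReal.ofReal_le_ofReal_iff (by positivity), ← Real.rpow_add hn0] at key2
  rw [← ofReal_measureReal]
  refine ENNReal.ofReal_le_ofReal ?_
  have e1 : (n : ℝ) ^ (-1 - δ) = n ^ (-(ε * h) + (-1 + δ)) * (n ^ δ * n ^ δ) := by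
    rw [← Real.rpow_add hn0, ← Real.rpow_add hn0, hδ]; ring_nf
  have e2 : (n : ℝ) ^ (-1 - ε * (h / 2 + q)) * n ^ δ * n ^ (ε * q) = n ^ (-1 - δ) := by
    rw [← Real.rpow_add hn0, ← Real.rpow_add hn0, hδ]; ring_nf
  have hA : 0 < (n : ℝ) ^ (-(ε * h) + (-1 + δ)) := by positivity
  have hB : 0 < (n : ℝ) ^ (-1 - ε * (h / 2 + q)) * n ^ (ε * q) := by positivity
  have hC : 0 < (n : ℝ) ^ (ε * q) := by positivity
  refine le_of_mul_le_mul_right ?_ hC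
  have h4 : (4 : ℝ) ≤ n ^ δ * n ^ δ := by nlinarith
  nlinarith [mul_le_mul_of_nonneg_left h4 hA.le, mul_le_mul_of_nonneg_left h2 hB.le]

/-- Secondary scale in the multiscale behavior: under the intermittent scaling function
hypotheses with `0 < α < β < ∞`, for every `ε > 0` the probability that `|W_n|` stays of
constant order satisfies
`-1 ≤ liminf (1/log n)·log P(n^{-ε} < |W_n| < n^{ε}) ≤ limsup ... ≤ -1 + αε`. -/
theorem multiscale_secondary_scale
    {Ω : Type*} [MeasurableSpace Ω] (P : Measure Ω) [IsProbabilityMeasure P]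
    (W : ℕ → Ω → ℝ) (hWmeas : ∀ n, Measurable (W n))
    (hW0 : ∀ n, P {ω | W n ω = 0} = 0)
    (α β : ℝ) (hα : 0 < α) (hαβ : α < β)
    (τ : ℝ → EReal)
    (hτ : ∀ q : ℝ, Tendsto (fun n : ℕ =>
        (((Real.log n)⁻¹ : ℝ) : EReal) *
          ENNReal.log (∫⁻ ω, ENNReal.ofReal (|W n ω| ^ q) ∂P))
      atTop (nhds (τ q)))
    (h0 : (0 : ℝ) ∈ interior {q : ℝ | τ q < ⊤})
    (hlin : ∀ q : ℝ, 0 ≤ q → q ≤ α → τ q = ((-(q / α) : ℝ) : EReal))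
    (hflat : ∀ q : ℝ, α < q → q < β → τ q = -1)
    (htop : ∀ q : ℝ, β < q → τ q = ⊤) :
    ∀ ε : ℝ, 0 < ε →
      (-1 : EReal) ≤
        Filter.liminf (fun n : ℕ =>
          (((Real.log n)⁻¹ : ℝ) : EReal) *
            ENNReal.log (P {ω | (n : ℝ) ^ (-ε) < |W n ω| ∧ |W n ω| < (n : ℝ) ^ ε}))
          atTop ∧
      Filter.liminf (fun n : ℕ =>
          (((Real.log n)⁻¹ : ℝ) : EReal) *
            ENNReal.log (P {ω | (n : ℝ) ^ (-ε) < |W n ω| ∧ |W n ω| < (n : ℝ) ^ ε}))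
          atTop ≤
        Filter.limsup (fun n : ℕ =>
          (((Real.log n)⁻¹ : ℝ) : EReal) *
            ENNReal.log (P {ω | (n : ℝ) ^ (-ε) < |W n ω| ∧ |W n ω| < (n : ℝ) ^ ε}))
          atTop ∧
      Filter.limsup (fun n : ℕ =>
          (((Real.log n)⁻¹ : ℝ) : EReal) *
            ENNReal.log (P {ω | (n : ℝ) ^ (-ε) < |W n ω| ∧ |W n ω| < (n : ℝ) ^ ε}))
          atTop ≤ ((-1 + α * ε : ℝ) : EReal) := by
  intro ε hε
  refine ⟨?_, liminf_le_limsup, ?_⟩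
  · obtain ⟨h, hh⟩ : ∃ h, h = (β - α) / 4 := ⟨_, rfl⟩
    have hh0 : 0 < h := by rw [hh]; linarith
    have hτ' : ∀ p ∈ ({(α + 2 * h) - h, α + 2 * h, (α + 2 * h) + h} : Set ℝ),
        Tendsto (fun n : ℕ => (((Real.log n)⁻¹ : ℝ) : EReal) *
          ENNReal.log (∫⁻ ω, ENNReal.ofReal (|W n ω| ^ p) ∂P))
          atTop (nhds ((-1 : ℝ) : EReal)) := by
      intro p hp
      have hp' : α < p ∧ p < β := by
        rcases hp with rfl | rfl | rfl <;> constructor <;> linarith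
      have := hτ p
      rwa [hflat p hp'.1 hp'.2] at this
    refine EReal.ge_of_forall_gt_iff_ge.1 fun z hz => ?_
    have hz1 : z < -1 := EReal.coe_lt_coe_iff.1 hz
    have hD : 0 < h / 2 + (α + 2 * h) := by positivity
    have hγ : 0 < (-1 - z) / (h / 2 + (α + 2 * h)) := div_pos (by linarith) hD
    refine le_liminf_of_le (by isBoundedDefault) ?_
    filter_upwards [eventually_rpow_le_measure_mid P hWmeas hh0 (by linarith) hτ'
      (lt_min hε hγ), eventually_ge_atTop 2] with n hn hn2
    have hn1 : (1 : ℝ) ≤ n := by exact_mod_cast one_le_two.trans hn2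
    rw [le_inv_log_mul_log_iff hn2]
    have hz2 := (le_div_iff₀ hD).1 (min_le_right ε ((-1 - z) / (h / 2 + (α + 2 * h))))
    refine (ENNReal.ofReal_le_ofReal (Real.rpow_le_rpow_of_exponent_le hn1 ?_)).trans
      (hn.trans (measure_mono fun ω hω => ⟨lt_of_le_of_lt ?_ hω.1, lt_of_lt_of_le hω.2 ?_⟩))
    · linarith
    · exact Real.rpow_le_rpow_of_exponent_le hn1 (neg_le_neg (min_le_left _ _))
    · exact Real.rpow_le_rpow_of_exponent_le hn1 (min_le_left _ _)
  · have hτα := hτ α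
    rw [hlin α hα.le le_rfl, div_self hα.ne'] at hτα
    refine EReal.le_of_forall_lt_iff_le.1 fun z hz => ?_
    have hz1 : -1 + α * ε < z := by exact_mod_cast hz
    refine limsup_le_of_le (by isBoundedDefault) ?_
    filter_upwards [eventually_le_of_tendsto_inv_log (d := z - α * ε) (by linarith) hτα,
      eventually_ge_atTop 2] with n hn hn2
    have hn0 : (0 : ℝ) < n := by positivity
    rw [inv_log_mul_log_le_iff hn2]
    calc P {ω | (n : ℝ) ^ (-ε) < |W n ω| ∧ |W n ω| < (n : ℝ) ^ ε}
        ≤ P {ω | (n : ℝ) ^ (-ε) < |W n ω|} := measure_mono fun ω hω => hω.1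
      _ ≤ ENNReal.ofReal ((n : ℝ) ^ (α * ε)) * ∫⁻ ω, ENNReal.ofReal (|W n ω| ^ α) ∂P :=
          measure_lt_abs_le_rpow_mul_lintegral P (hWmeas n) hn0 hα
      _ ≤ ENNReal.ofReal ((n : ℝ) ^ (α * ε)) * ENNReal.ofReal ((n : ℝ) ^ (z - α * ε)) := by
          gcongr
      _ = ENNReal.ofReal ((n : ℝ) ^ z) := by
          rw [← ENNReal.ofReal_mul (by positivity), ← Real.rpow_add hn0]
          ring_nf
end

section
/- No scales above constant order when all moments are finite: let α > 0 and let (W_n)_{n≥2} be real-valued random variables with P(W_n = 0) = 0 for all n, such that for every q ∈ ℝ the limit τ(q) = lim_{n→∞} (1/log n)·log E|W_n|^q exists as an extended real number, 0 lies in the interior of { q : τ(q) < ∞ }, τ(q) = −q/α for 0 ≤ q ≤ α, and τ(q) = −1 for all q > α. Then for every ε > 0: lim_{n→∞} (1/log n)·log P( |W_n| > n^{ε} ) = −∞. -/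
open MeasureTheory Filter Real
open scoped ENNReal

/-- No scales above constant order when all moments are finite: if the scaling function
`τ(q) = lim_n (1/log n)·log E|W_n|^q` exists in the extended reals for every `q`, `0` is
interior to `{q | τ(q) < ∞}`, `τ(q) = -q/α` on `[0, α]` and `τ(q) = -1` for all `q > α`,
then for every `ε > 0`, `(1/log n)·log P(|W_n| > n^{ε}) → -∞`. -/
theorem multiscale_no_large_scales
    {Ω : Type*} [MeasurableSpace Ω] (P : Measure Ω) [IsProbabilityMeasure P]
    (W : ℕ → Ω → ℝ) (hWmeas : ∀ n, Measurable (W n))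
    (hW0 : ∀ n, P {ω | W n ω = 0} = 0)
    (α : ℝ) (hα : 0 < α)
    (τ : ℝ → EReal)
    (hτ : ∀ q : ℝ, Tendsto (fun n : ℕ =>
        (((Real.log n)⁻¹ : ℝ) : EReal) *
          ENNReal.log (∫⁻ ω, ENNReal.ofReal (|W n ω| ^ q) ∂P))
      atTop (nhds (τ q)))
    (h0 : (0 : ℝ) ∈ interior {q : ℝ | τ q < ⊤})
    (hlin : ∀ q : ℝ, 0 ≤ q → q ≤ α → τ q = ((-(q / α) : ℝ) : EReal))
    (hflat : ∀ q : ℝ, α < q → τ q = -1) :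
    ∀ ε : ℝ, 0 < ε →
      Tendsto (fun n : ℕ =>
          (((Real.log n)⁻¹ : ℝ) : EReal) *
            ENNReal.log (P {ω | (n : ℝ) ^ ε < |W n ω|}))
        atTop (nhds (⊥ : EReal)) := by
  intro ε hε
  rw [EReal.tendsto_nhds_bot_iff_real]
  intro y
  obtain ⟨q, hqα, hqy⟩ : ∃ q : ℝ, α < q ∧ -(ε * q) < y := by
    refine ⟨max (α + 1) ((1 - y) / ε), lt_of_lt_of_le (by linarith) (le_max_left _ _), ?_⟩
    have h : 1 - y ≤ ε * max (α + 1) ((1 - y) / ε) := by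
      rw [← div_le_iff₀' hε]
      exact le_max_right _ _
    linarith
  have hlim := hτ q
  rw [hflat q hqα] at hlim
  have hneg : (-1 : EReal) < 0 := by
    simp
  filter_upwards [hlim.eventually_lt_const hneg, eventually_gt_atTop 1] with n hn hn1
  have hn0 : (0 : ℝ) < n := by positivity
  have hL : 0 < Real.log n := Real.log_pos (by exact_mod_cast hn1)
  have hL' : (0 : EReal) ≤ ((Real.log n)⁻¹ : ℝ) := by exact_mod_cast (inv_pos.2 hL).le
  have hmoment : ∫⁻ ω, ENNReal.ofReal (|W n ω| ^ q) ∂P ≤ 1 := by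
    by_contra! h
    have h1 : 0 ≤ ENNReal.log (∫⁻ ω, ENNReal.ofReal (|W n ω| ^ q) ∂P) := by
      rw [← ENNReal.log_one]
      exact ENNReal.log_le_log h.le
    exact absurd hn (not_lt.2 (mul_nonneg hL' h1))
  have hpos : 0 < (n : ℝ) ^ (ε * q) := Real.rpow_pos_of_pos hn0 _
  have hmarkov : P {ω | (n : ℝ) ^ ε < |W n ω|} ≤ ENNReal.ofReal ((n : ℝ) ^ (-(ε * q))) := by
    calc P {ω | (n : ℝ) ^ ε < |W n ω|}
        ≤ P {ω | ENNReal.ofReal ((n : ℝ) ^ (ε * q)) ≤ ENNReal.ofReal (|W n ω| ^ q)} := by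
          refine measure_mono fun ω hω => ENNReal.ofReal_le_ofReal ?_
          rw [Real.rpow_mul hn0.le]
          exact Real.rpow_le_rpow (Real.rpow_nonneg hn0.le _) (le_of_lt hω) (hα.trans hqα).le
      _ ≤ (∫⁻ ω, ENNReal.ofReal (|W n ω| ^ q) ∂P) / ENNReal.ofReal ((n : ℝ) ^ (ε * q)) :=
          meas_ge_le_lintegral_div
            (((hWmeas n).abs.pow_const q).ennreal_ofReal.aemeasurable)
            (ENNReal.ofReal_pos.2 hpos).ne' ENNReal.ofReal_ne_top
      _ ≤ 1 / ENNReal.ofReal ((n : ℝ) ^ (ε * q)) := by gcongr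
      _ = ENNReal.ofReal ((n : ℝ) ^ (-(ε * q))) := by
          rw [Real.rpow_neg hn0.le, ENNReal.ofReal_inv_of_pos hpos, one_div]
  calc (((Real.log n)⁻¹ : ℝ) : EReal) * ENNReal.log (P {ω | (n : ℝ) ^ ε < |W n ω|})
      ≤ (((Real.log n)⁻¹ : ℝ) : EReal) *
          ENNReal.log (ENNReal.ofReal ((n : ℝ) ^ (-(ε * q)))) :=
        mul_le_mul_of_nonneg_left (ENNReal.log_le_log hmarkov) hL'
    _ = ((-(ε * q) : ℝ) : EReal) := by
        rw [ENNReal.log_ofReal_of_pos (Real.rpow_pos_of_pos hn0 _), Real.log_rpow hn0,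
          ← EReal.coe_mul]
        congr 1
        field_simp
    _ < y := by exact_mod_cast hqy
end
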